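/- A continuum X is graph-like if and only if X is regular and there exists a closed zero-dimensional subset V ⊆ X such that every point of X ∖ V has order 2. -/

import Mathlib

open Set Topology Filter Function

universe u

/-- A compact graph-like space structure on a topological space `X`:
a closed zero-dimensional vertex set `V` together with an index type `E`
(carrying the discrete topology) such that `X \ V ≅ E × (0,1)`. -/
structure GraphLike (X : Type u) [TopologicalSpace X] where
  V : Set X
  closedV : IsClosed V
  zeroDimV : TotallyDisconnectedSpace V
  E : Type
  homeo :
    letI : TopologicalSpace E := ⊥
    Nonempty ((Vᶜ : Set X) ≃ₜ (E × ↥(Set.Ioo (0 : ℝ) 1)))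

variable {X : Type u} [TopologicalSpace X]

/-- An edge of a graph-like space: a connected component of `X \ V`. -/
def GraphLike.IsEdge (G : GraphLike X) (e : Set X) : Prop :=
  ∃ x, x ∈ (G.V)ᶜ ∧ e = connectedComponentIn (G.V)ᶜ x

/-- A subset of the vertex set which is clopen in the subspace `V`. -/
def GraphLike.ClopenIn (G : GraphLike X) (C : Set X) : Prop :=
  C ⊆ G.V ∧ IsClosed C ∧ IsClosed (G.V \ C)

/-- A separation of a graph-like space: a partition of the vertex set into
two disjoint clopen pieces. -/
structure GraphLike.Separation (G : GraphLike X) where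
  A : Set X
  B : Set X
  clopenA : G.ClopenIn A
  clopenB : G.ClopenIn B
  disjoint : A ∩ B = ∅
  union : A ∪ B = G.V

/-- The cut induced by a pair of vertex sets: all edges whose closure meets both. -/
def GraphLike.cut (G : GraphLike X) (A B : Set X) : Set (Set X) :=
  {e | G.IsEdge e ∧ (closure e ∩ A).Nonempty ∧ (closure e ∩ B).Nonempty}

/-- A cut is even if it is finite of even cardinality. -/
def GraphLike.EvenCut (G : GraphLike X) (A B : Set X) : Prop :=
  (G.cut A B).Finite ∧ Even (G.cut A B).ncard

/-- A point has order at most `n` if every open neighbourhood contains an open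
neighbourhood whose boundary has at most `n` points. -/
def HasOrderLE (x : X) (n : ℕ) : Prop :=
  ∀ U : Set X, IsOpen U → x ∈ U →
    ∃ W : Set X, IsOpen W ∧ x ∈ W ∧ W ⊆ U ∧ (frontier W).Finite ∧ (frontier W).ncard ≤ n

/-- A point has order `2` if it has order `≤ 2` but not order `≤ 1`. -/
def HasOrderTwo (x : X) : Prop :=
  HasOrderLE x 2 ∧ ¬ HasOrderLE x 1

lemma cross_frontier {Y : Type*} [TopologicalSpace Y] {S W : Set Y} (hS : IsPreconnected S)
    (hW : IsOpen W) (h1 : (S ∩ W).Nonempty) (h2 : (S \ W).Nonempty) :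
    (S ∩ frontier W).Nonempty := by
  by_contra h
  rw [not_nonempty_iff_eq_empty] at h
  have hsub : S ⊆ W ∪ (closure W)ᶜ := by
    intro y hy
    by_cases hyW : y ∈ W
    · exact Or.inl hyW
    · right
      intro hc
      have : y ∈ S ∩ frontier W := ⟨hy, by rw [hW.frontier_eq]; exact ⟨hc, hyW⟩⟩
      rw [h] at this
      exact this
  obtain ⟨z, hz⟩ := h2
  have hz' : z ∈ (closure W)ᶜ := (hsub hz.1).resolve_left hz.2
  obtain ⟨y, _, hy1, hy2⟩ := hS W (closure W)ᶜ hW isClosed_closure.isOpen_compl hsub h1 ⟨z, hz.1, hz'⟩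
  exact hy2 (subset_closure hy1)

def RegB (Y : Type*) [TopologicalSpace Y] : Prop :=
  ∀ (x : Y) (U : Set Y), IsOpen U → x ∈ U → ∃ W, IsOpen W ∧ x ∈ W ∧ W ⊆ U ∧ (frontier W).Finite

lemma bump {Y : Type*} [TopologicalSpace Y] [CompactSpace Y] [T2Space Y] [ConnectedSpace Y]
    {W : Set Y} (hW : IsOpen W) (hF : (frontier W).Finite) (hne : (frontier W).Nonempty)
    (y : closure W) : ∃ p ∈ connectedComponent y, (p : Y) ∈ frontier W := by
  by_contra! h
  have : CompactSpace (closure W) := isCompact_iff_compactSpace.1 isClosed_closure.isCompact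
  have h1 : ∀ p : closure W, (p : Y) ∈ frontier W → ∃ s : Set (closure W), IsClopen s ∧ y ∈ s ∧ p ∉ s := by
    intro p hp
    have : p ∉ connectedComponent y := fun hc => h p hc hp
    rw [connectedComponent_eq_iInter_isClopen] at this
    simp only [mem_iInter, not_forall] at this
    obtain ⟨⟨s, hs1, hs2⟩, hs3⟩ := this
    exact ⟨s, hs1, hs2, hs3⟩
  choose! s hs1 hs2 hs3 using h1
  let F : Set (closure W) := Subtype.val ⁻¹' frontier W
  have hFf : F.Finite := hF.preimage Subtype.val_injective.injOn
  let R : Set (closure W) := ⋂ p ∈ F, s p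
  have hR : IsClopen R := hFf.isClopen_biInter fun p hp => hs1 p hp
  have hyR : y ∈ R := by simp only [R, mem_iInter]; exact fun p hp => hs2 p hp
  have hRF : ∀ p ∈ R, (p : Y) ∉ frontier W := by
    intro p hp hpF
    simp only [R, mem_iInter] at hp
    exact hs3 p hpF (hp p hpF)
  have hRW : ∀ p ∈ R, (p : Y) ∈ W := by
    intro p hp
    by_contra hpW
    exact hRF p hp (by rw [hW.frontier_eq]; exact ⟨p.2, hpW⟩)
  have hcl : IsClosed (Subtype.val '' R) := isClosed_closure.isClosedMap_subtype_val _ hR.1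
  have hop : IsOpen (Subtype.val '' R) := by
    obtain ⟨O, hO, hOR⟩ := isOpen_induced_iff.1 hR.2
    have : Subtype.val '' R = O ∩ W := by
      ext z
      constructor
      · rintro ⟨p, hp, rfl⟩
        refine ⟨?_, hRW p hp⟩
        rw [← hOR] at hp
        exact hp
      · rintro ⟨hz1, hz2⟩
        exact ⟨⟨z, subset_closure hz2⟩, by rw [← hOR]; exact hz1, rfl⟩
    rw [this]
    exact hO.inter hW
  have huniv := IsClopen.eq_univ ⟨hcl, hop⟩ ⟨_, mem_image_of_mem _ hyR⟩
  obtain ⟨q, hq⟩ := hne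
  have : q ∈ Subtype.val '' R := huniv ▸ mem_univ q
  obtain ⟨p, hp, rfl⟩ := this
  exact hRF p hp hq

lemma RegB.small {Y : Type*} [TopologicalSpace Y] [RegularSpace Y] (hY : RegB Y)
    (x : Y) (U : Set Y) (hU : U ∈ 𝓝 x) :
    ∃ W, IsOpen W ∧ x ∈ W ∧ closure W ⊆ U ∧ (frontier W).Finite := by
  obtain ⟨t, ht, htc, htU⟩ := exists_mem_nhds_isClosed_subset hU
  obtain ⟨W, hW, hx, hWt, hf⟩ := hY x (interior t) isOpen_interior (mem_interior_iff_mem_nhds.2 ht)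
  exact ⟨W, hW, hx, (closure_minimal (hWt.trans interior_subset) htc).trans htU, hf⟩

lemma RegB.locallyConnected {Y : Type*} [TopologicalSpace Y] [CompactSpace Y] [T2Space Y]
    [ConnectedSpace Y] (hY : RegB Y) : LocallyConnectedSpace Y := by
  rw [locallyConnectedSpace_iff_connected_subsets]
  intro x U hU
  obtain ⟨W, hW, hx, hWU, hf⟩ := hY.small x U hU
  by_cases hne : (frontier W).Nonempty
  · have : CompactSpace (closure W) := isCompact_iff_compactSpace.1 isClosed_closure.isCompact
    have hsurj : ∀ c : ConnectedComponents (closure W),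
        c ∈ (fun p : closure W => (p : ConnectedComponents (closure W))) '' (Subtype.val ⁻¹' frontier W) := by
      intro c
      obtain ⟨y, rfl⟩ := ConnectedComponents.surjective_coe c
      obtain ⟨p, hp, hpF⟩ := bump hW hf hne y
      exact ⟨p, hpF, ConnectedComponents.coe_eq_coe'.2 hp⟩
    have : Finite (ConnectedComponents (closure W)) := by
      apply Set.finite_univ_iff.1
      refine Set.Finite.subset ((hf.preimage Subtype.val_injective.injOn).image _) (fun c _ => hsurj c)
    have hd : DiscreteTopology (ConnectedComponents (closure W)) := inferInstance
    rw [ConnectedComponents.discreteTopology_iff] at hd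
    have hop := hd ⟨x, subset_closure hx⟩
    obtain ⟨O, hO, hOK⟩ := isOpen_induced_iff.1 hop
    refine ⟨Subtype.val '' connectedComponent (⟨x, subset_closure hx⟩ : closure W), ?_,
      isPreconnected_connectedComponent.image _ continuous_subtype_val.continuousOn, ?_⟩
    · refine mem_of_superset ((hO.inter hW).mem_nhds ⟨?_, hx⟩) ?_
      · have : (⟨x, subset_closure hx⟩ : closure W) ∈ Subtype.val ⁻¹' O := by
          rw [hOK]; exact mem_connectedComponent
        exact this
      · rintro z ⟨hz1, hz2⟩
        exact ⟨⟨z, subset_closure hz2⟩, by rw [← hOK]; exact hz1, rfl⟩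
    · rintro _ ⟨p, _, rfl⟩
      exact hWU p.2
  · have : W = univ := by
      rw [not_nonempty_iff_eq_empty, frontier_eq_empty_iff] at hne
      exact hne.resolve_left (fun h => by simp [h] at hx)
    refine ⟨univ, univ_mem, isPreconnected_univ, ?_⟩
    rw [← this]
    exact subset_closure.trans hWU

lemma RegB.sub {Y : Type*} [TopologicalSpace Y] (hY : RegB Y) (A : Set Y) : RegB A := by
  rintro x U hU hx
  obtain ⟨O, hO, rfl⟩ := isOpen_induced_iff.1 hU
  obtain ⟨W, hW, hxW, hWO, hf⟩ := hY x O hO hx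
  refine ⟨Subtype.val ⁻¹' W, hW.preimage continuous_subtype_val, hxW, preimage_mono hWO, ?_⟩
  exact (hf.preimage Subtype.val_injective.injOn).subset
    (continuous_subtype_val.frontier_preimage_subset W)

/-- points in an open connected set lie in a closed connected subset -/
lemma conn_join {Y : Type*} [TopologicalSpace Y] [RegularSpace Y] [LocallyConnectedSpace Y]
    {P : Set Y} (hP : IsOpen P) (hc : IsPreconnected P) {a b : Y} (ha : a ∈ P) (hb : b ∈ P) :
    ∃ K, IsClosed K ∧ IsPreconnected K ∧ K ⊆ P ∧ a ∈ K ∧ b ∈ K := by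
  refine hc.induction₂ (fun x y => ∃ K, IsClosed K ∧ IsPreconnected K ∧ K ⊆ P ∧ x ∈ K ∧ y ∈ K)
    ?_ ?_ ?_ ha hb
  · intro x hx
    obtain ⟨t, ht, htc, htU⟩ := exists_mem_nhds_isClosed_subset (hP.mem_nhds hx)
    obtain ⟨N, hN, hNc, hNt⟩ := locallyConnectedSpace_iff_connected_subsets.1 ‹_› x t ht
    filter_upwards [mem_nhdsWithin_of_mem_nhds hN] with y hy
    exact ⟨closure N, isClosed_closure, hNc.closure, (closure_minimal hNt htc).trans htU,
      subset_closure (mem_of_mem_nhds hN), subset_closure hy⟩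
  · rintro x y z _ _ _ ⟨K, h1, h2, h3, h4, h5⟩ ⟨L, k1, k2, k3, k4, k5⟩
    exact ⟨K ∪ L, h1.union k1, h2.union y h5 k4 k2, union_subset h3 k3, Or.inl h4, Or.inr k5⟩
  · rintro x y _ _ ⟨K, h1, h2, h3, h4, h5⟩
    exact ⟨K, h1, h2, h3, h5, h4⟩

lemma chain_preconn {Y : Type*} [TopologicalSpace Y] [CompactSpace Y] [T2Space Y]
    {c : Set (Set Y)} (hc : IsChain (· ⊆ ·) c) (hne : c.Nonempty)
    (h : ∀ K ∈ c, IsClosed K ∧ IsPreconnected K) : IsPreconnected (⋂₀ c) := by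
  have hcl : IsClosed (⋂₀ c) := isClosed_sInter fun K hK => (h K hK).1
  rw [isPreconnected_iff_subset_of_fully_disjoint_closed hcl]
  intro u v hu hv huv hd
  -- replace by disjoint closed subsets of the intersection and separate
  obtain ⟨O, O', hO, hO', hsO, hsO', hdd⟩ := normal_separation (hu.inter hcl) (hv.inter hcl)
    (hd.mono inter_subset_left inter_subset_left)
  have hex : ∃ K ∈ c, K ⊆ O ∪ O' := by
    have : Nonempty c := hne.to_subtype
    have := exists_subset_nhds_of_isCompact' (V := fun K : c => (K : Set Y)) ?_ 
      (fun K => (h K K.2).1.isCompact) (fun K => (h K K.2).1) (U := O ∪ O') ?_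
    · obtain ⟨K, hK⟩ := this
      exact ⟨K, K.2, hK⟩
    · intro K L
      rcases hc.total K.2 L.2 with h | h
      · exact ⟨K, subset_rfl, h⟩
      · exact ⟨L, h, subset_rfl⟩
    · intro x hx
      have hx' : x ∈ ⋂₀ c := by rw [sInter_eq_iInter]; exact hx
      refine (hO.union hO').mem_nhds ?_
      rcases huv hx' with h | h
      · exact Or.inl (hsO ⟨h, hx'⟩)
      · exact Or.inr (hsO' ⟨h, hx'⟩)
  obtain ⟨K, hK, hKO⟩ := hex
  have hsub : ⋂₀ c ⊆ K := sInter_subset_of_mem hK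
  rcases (isPreconnected_iff_subset_of_disjoint.1 (h K hK).2) O O' hO hO' hKO (by
    rw [hdd.inter_eq, inter_empty]) with h | h
  · left
    intro x hx
    rcases huv hx with hx' | hx'
    · exact hx'
    · exact (disjoint_left.1 hdd (h (hsub hx)) (hsO' ⟨hx', hx⟩)).elim
  · right
    intro x hx
    rcases huv hx with hx' | hx'
    · exact (disjoint_left.1 hdd (hsO ⟨hx', hx⟩) (h (hsub hx))).elim
    · exact hx'

lemma exists_irred {Y : Type*} [TopologicalSpace Y] [CompactSpace Y] [T2Space Y]
    {C : Set Y} (hC : IsClosed C) (hc : IsPreconnected C) {a b : Y} (ha : a ∈ C) (hb : b ∈ C) :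
    ∃ A ⊆ C, IsClosed A ∧ IsPreconnected A ∧ a ∈ A ∧ b ∈ A ∧
      ∀ K ⊆ A, IsClosed K → IsPreconnected K → a ∈ K → b ∈ K → K = A := by
  obtain ⟨A, hAC, hA⟩ := zorn_superset_nonempty
    {K : Set Y | IsClosed K ∧ IsPreconnected K ∧ a ∈ K ∧ b ∈ K} (by
      intro c hcS hchain hne
      refine ⟨⋂₀ c, ⟨isClosed_sInter fun K hK => (hcS hK).1,
        chain_preconn hchain hne fun K hK => ⟨(hcS hK).1, (hcS hK).2.1⟩,
        fun K hK => (hcS hK).2.2.1, fun K hK => (hcS hK).2.2.2⟩, fun s hs => sInter_subset_of_mem hs⟩)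
    C ⟨hC, hc, ha, hb⟩
  refine ⟨A, hAC, hA.prop.1, hA.prop.2.1, hA.prop.2.2.1, hA.prop.2.2.2, ?_⟩
  intro K hK h1 h2 h3 h4
  exact subset_antisymm hK (hA.le_of_le ⟨h1, h2, h3, h4⟩ hK)
structure CutSys (Y : Type*) [TopologicalSpace Y] (a b : Y) where
  P : Y → Set Y
  Q : Y → Set Y
  oP : ∀ p, IsOpen (P p)
  oQ : ∀ p, IsOpen (Q p)
  disj : ∀ p, Disjoint (P p) (Q p)
  nP : ∀ p, p ∉ P p
  nQ : ∀ p, p ∉ Q p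
  cov : ∀ p x, x ≠ p → x ∈ P p ∨ x ∈ Q p
  ha : ∀ p, a = p ∨ a ∈ P p
  hb : ∀ p, b = p ∨ b ∈ Q p

lemma cut_exists {Y : Type*} [TopologicalSpace Y] [T2Space Y] [RegularSpace Y]
    [LocallyConnectedSpace Y] {a b : Y}
    (hir : ∀ K : Set Y, IsClosed K → IsPreconnected K → a ∈ K → b ∈ K → K = univ) :
    Nonempty (CutSys Y a b) := by
  have key : ∀ p : Y, ∃ P Q : Set Y, IsOpen P ∧ IsOpen Q ∧ Disjoint P Q ∧ p ∉ P ∧ p ∉ Q ∧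
      (∀ x, x ≠ p → x ∈ P ∨ x ∈ Q) ∧ (a = p ∨ a ∈ P) ∧ (b = p ∨ b ∈ Q) := by
    intro p
    by_cases hpa : a = p
    · refine ⟨∅, {p}ᶜ, isOpen_empty, isOpen_compl_singleton, by simp, by simp, by simp,
        fun x hx => Or.inr hx, Or.inl hpa, ?_⟩
      by_cases h : b = p
      · exact Or.inl h
      · exact Or.inr h
    by_cases hpb : b = p
    · exact ⟨{p}ᶜ, ∅, isOpen_compl_singleton, isOpen_empty, by simp, by simp, by simp,
        fun x hx => Or.inl hx, Or.inr hpa, Or.inl hpb⟩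
    have ho : IsOpen ({p}ᶜ : Set Y) := isOpen_compl_singleton
    refine ⟨connectedComponentIn {p}ᶜ a, {p}ᶜ \ connectedComponentIn {p}ᶜ a,
      ho.connectedComponentIn, ?_, disjoint_sdiff_right,
      fun h => connectedComponentIn_subset _ _ h rfl, fun h => h.1 rfl, ?_,
      Or.inr (mem_connectedComponentIn hpa), Or.inr ⟨hpb, ?_⟩⟩
    · rw [isOpen_iff_mem_nhds]
      rintro y ⟨hy1, hy2⟩
      refine mem_of_superset ((ho.connectedComponentIn (x := y)).mem_nhds
        (mem_connectedComponentIn hy1)) ?_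
      intro z hz
      refine ⟨connectedComponentIn_subset _ _ hz, fun hz2 => hy2 ?_⟩
      rw [connectedComponentIn_eq hz2, ← connectedComponentIn_eq hz]
      exact mem_connectedComponentIn hy1
    · intro x hx
      by_cases h : x ∈ connectedComponentIn {p}ᶜ a
      · exact Or.inl h
      · exact Or.inr ⟨hx, h⟩
    · intro hb
      obtain ⟨K, h1, h2, h3, h4, h5⟩ := conn_join (ho.connectedComponentIn (x := a))
        isPreconnected_connectedComponentIn (mem_connectedComponentIn hpa) hb
      have := hir K h1 h2 h4 h5
      have hp : p ∈ K := this ▸ mem_univ p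
      exact connectedComponentIn_subset _ _ (h3 hp) rfl
  choose P Q h using key
  exact ⟨⟨P, Q, fun p => (h p).1, fun p => (h p).2.1, fun p => (h p).2.2.1, fun p => (h p).2.2.2.1,
    fun p => (h p).2.2.2.2.1, fun p => (h p).2.2.2.2.2.1, fun p => (h p).2.2.2.2.2.2.1,
    fun p => (h p).2.2.2.2.2.2.2⟩⟩

lemma cut_conn {Y : Type*} [TopologicalSpace Y] [PreconnectedSpace Y] {P Q : Set Y} {p : Y}
    (hP : IsOpen P) (hQ : IsOpen Q) (hd : Disjoint P Q) (hc : ∀ x, x ≠ p → x ∈ P ∨ x ∈ Q) :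
    IsPreconnected (insert p P) := by
  classical
  let f : Y → Y := fun x => if x ∈ P then x else p
  have hf : Continuous f := by
    refine Continuous.if ?_ continuous_id continuous_const
    intro x hx
    by_contra hne
    have hfr : x ∈ frontier P := hx
    rw [hP.frontier_eq] at hfr
    rcases hc x hne with h | h
    · exact hfr.2 h
    · obtain ⟨z, hz1, hz2⟩ := mem_closure_iff.1 hfr.1 Q hQ h
      exact disjoint_left.1 hd hz2 hz1
  have hr : insert p P = insert p (range f) := by
    ext x
    constructor
    · rintro (h | h)
      · exact Or.inl h
      · exact Or.inr ⟨x, if_pos h⟩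
    · rintro (h | ⟨y, rfl⟩)
      · exact Or.inl h
      · by_cases hy : y ∈ P
        · right; simp [f, hy]
        · left; simp [f, hy]
  have hr2 := isPreconnected_range hf
  by_cases hp : p ∈ range f
  · rw [hr, insert_eq_of_mem hp]; exact hr2
  · have : P = univ := by
      ext x
      simp only [mem_univ, iff_true]
      by_contra h
      exact hp ⟨x, if_neg h⟩
    rw [this]; simp [isPreconnected_univ]

namespace CutSys
variable {Y : Type*} [TopologicalSpace Y] [PreconnectedSpace Y] {a b : Y} (c : CutSys Y a b)

lemma connP (p : Y) : IsPreconnected (insert p (c.P p)) :=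
  cut_conn (c.oP p) (c.oQ p) (c.disj p) (c.cov p)

lemma connQ (p : Y) : IsPreconnected (insert p (c.Q p)) :=
  cut_conn (c.oQ p) (c.oP p) (c.disj p).symm (fun x hx => (c.cov p x hx).symm)

lemma subP {p q : Y} (h : q ∈ c.Q p) : insert p (c.P p) ⊆ c.P q := by
  have hqn : q ∉ insert p (c.P p) := by
    rintro (h1 | h1)
    · exact c.nQ p (h1 ▸ h)
    · exact disjoint_left.1 (c.disj p) h1 h
  have haI : a ∈ insert p (c.P p) := c.ha p
  have haq : a ∈ c.P q := (c.ha q).resolve_left (fun h => hqn (h ▸ haI))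
  exact (c.connP p).subset_left_of_subset_union (c.oP q) (c.oQ q) (c.disj q)
    (fun x hx => c.cov q x (fun h => hqn (h ▸ hx))) ⟨a, haI, haq⟩

lemma subQ {p q : Y} (h : q ∈ c.P p) : insert p (c.Q p) ⊆ c.Q q := by
  have hqn : q ∉ insert p (c.Q p) := by
    rintro (h1 | h1)
    · exact c.nP p (h1 ▸ h)
    · exact disjoint_left.1 (c.disj p) h h1
  have haI : b ∈ insert p (c.Q p) := c.hb p
  have haq : b ∈ c.Q q := (c.hb q).resolve_left (fun h => hqn (h ▸ haI))
  exact (c.connQ p).subset_right_of_subset_union (c.oP q) (c.oQ q) (c.disj q)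
    (fun x hx => c.cov q x (fun h => hqn (h ▸ hx))) ⟨b, haI, haq⟩

lemma mem_iff {p q : Y} : q ∈ c.Q p ↔ p ∈ c.P q :=
  ⟨fun h => c.subP h (mem_insert _ _), fun h => c.subQ h (mem_insert _ _)⟩

lemma arc {Y : Type*} [TopologicalSpace Y] [PreconnectedSpace Y] {a b : Y} (c : CutSys Y a b)
    [TopologicalSpace.SeparableSpace Y] (hab : a ≠ b) :
    ∃ f : Y → ℝ, Continuous f ∧ Injective f ∧ ∀ y, f a ≤ f y ∧ f y ≤ f b := by
  classical
  let r : Y → Y → Prop := fun x y => x ∈ c.P y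
  have htr : ∀ x y z, r x y → r y z → r x z := fun x y z h1 h2 =>
    c.subP (c.mem_iff.2 h2) (mem_insert_of_mem _ h1)
  have htri : ∀ x y, x ≠ y → r x y ∨ r y x := fun x y h =>
    (c.cov y x h).imp id (fun h => c.mem_iff.1 h)
  let _ : IsStrictTotalOrder Y r :=
    { irrefl := fun x => c.nP x
      trans := htr
      trichotomous := fun x y h1 h2 => by
        by_contra h
        rcases htri x y h with h | h
        · exact h1 h
        · exact h2 h }
  let _ : LinearOrder Y := linearOrderOfSTO r
  have hlt : ∀ x y : Y, x < y ↔ x ∈ c.P y := fun x y => Iff.rfl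
  have hlt' : ∀ x y : Y, x < y ↔ y ∈ c.Q x := fun x y => (c.mem_iff).symm
  have ha : ∀ y, a ≤ y := fun y => (c.ha y).elim (fun h => h.le) (fun h => le_of_lt ((hlt _ _).2 h))
  have hb : ∀ y, y ≤ b := fun y => (c.hb y).elim (fun h => h.ge) (fun h => le_of_lt ((hlt' _ _).2 h))
  have hab' : a < b := lt_of_le_of_ne (ha b) hab
  obtain ⟨S, hSc, hSd⟩ := TopologicalSpace.exists_countable_dense Y
  have hdense : ∀ x y : Y, x < y → ∃ s ∈ S, x < s ∧ s < y := by
    intro x y hxy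
    have hne : (univ ∩ (c.P y ∩ c.Q x)).Nonempty := by
      refine isPreconnected_univ (α := Y) _ _ (c.oP y) (c.oQ x) ?_ ⟨x, mem_univ _, hxy⟩
        ⟨y, mem_univ _, (hlt' _ _).1 hxy⟩
      intro z _
      rcases lt_or_ge z y with h | h
      · exact Or.inl h
      · exact Or.inr ((hlt' _ _).1 (hxy.trans_le h))
    rw [univ_inter] at hne
    obtain ⟨s, hs, hsS⟩ := hSd.inter_open_nonempty _ ((c.oP y).inter (c.oQ x)) hne
    exact ⟨s, hsS, (hlt' _ _).2 hs.2, hs.1⟩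
  let D : Set Y := {s | s ∈ S ∧ a < s ∧ s < b}
  have hD : ∀ x y : Y, x < y → ∃ d : D, x < d ∧ (d : Y) < y := by
    intro x y hxy
    obtain ⟨s, hs, h1, h2⟩ := hdense x y hxy
    exact ⟨⟨s, hs, (ha x).trans_lt h1, h2.trans_le (hb y)⟩, h1, h2⟩
  have : Countable D := (hSc.mono fun x hx => hx.1).to_subtype
  have : Nonempty D := let ⟨d, _⟩ := hD a b hab'; ⟨d⟩
  have : DenselyOrdered D := ⟨fun x y h => by
    obtain ⟨d, h1, h2⟩ := hD x y h
    exact ⟨d, h1, h2⟩⟩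
  have : NoMinOrder D := ⟨fun x => by
    obtain ⟨d, h1, h2⟩ := hD a x x.2.2.1
    exact ⟨d, h2⟩⟩
  have : NoMaxOrder D := ⟨fun x => by
    obtain ⟨d, h1, h2⟩ := hD x b x.2.2.2
    exact ⟨d, h1⟩⟩
  have : Nonempty (Ioo (0:ℚ) 1) := ⟨⟨1/2, by norm_num, by norm_num⟩⟩
  obtain ⟨φ⟩ := Order.iso_of_countable_dense D (Ioo (0:ℚ) 1)
  let T : Y → Set ℝ := fun x => insert 0 {t | ∃ d : D, (d : Y) < x ∧ t = ((φ d : ℚ) : ℝ)}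
  have hφ0 : ∀ d, (0:ℝ) < ((φ d : ℚ) : ℝ) := fun d => by exact_mod_cast (φ d).2.1
  have hφ1 : ∀ d, ((φ d : ℚ) : ℝ) < 1 := fun d => by exact_mod_cast (φ d).2.2
  have hφlt : ∀ d e : D, d < e → ((φ d : ℚ) : ℝ) < ((φ e : ℚ) : ℝ) := fun d e h => by
    have : φ d < φ e := φ.strictMono h
    exact_mod_cast this
  have hTb : ∀ x, BddAbove (T x) := by
    intro x
    refine ⟨1, ?_⟩
    rintro t (rfl | ⟨d, _, rfl⟩)
    · exact zero_le_one
    · exact (hφ1 d).le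
  have hTn : ∀ x, (T x).Nonempty := fun x => ⟨0, Or.inl rfl⟩
  let f : Y → ℝ := fun x => sSup (T x)
  have hmono : Monotone f := by
    intro x y hxy
    refine csSup_le_csSup (hTb y) (hTn x) ?_
    rintro t (rfl | ⟨d, h, rfl⟩)
    · exact Or.inl rfl
    · exact Or.inr ⟨d, h.trans_le hxy, rfl⟩
  have h0 : ∀ x, 0 ≤ f x := fun x => le_csSup (hTb x) (Or.inl rfl)
  have hge : ∀ (d : D) (x : Y), (d : Y) < x → ((φ d : ℚ) : ℝ) ≤ f x := fun d x h =>
    le_csSup (hTb x) (Or.inr ⟨d, h, rfl⟩)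
  have hle : ∀ (d : D) (x : Y), x ≤ d → f x ≤ ((φ d : ℚ) : ℝ) := by
    intro d x h
    refine csSup_le (hTn x) ?_
    rintro t (rfl | ⟨e, he, rfl⟩)
    · exact (hφ0 d).le
    · exact (hφlt e d (he.trans_le h)).le
  have hsm : StrictMono f := by
    intro x y hxy
    obtain ⟨d, h1, h2⟩ := hD x y hxy
    obtain ⟨e, h3, h4⟩ := hD d y h2
    exact (hle d x h1.le).trans_lt ((hφlt d e h3).trans_le (hge e y h4))
  refine ⟨f, ?_, hsm.injective, fun y => ⟨hmono (ha y), hmono (hb y)⟩⟩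
  rw [OrderTopology.continuous_iff]
  intro s
  constructor
  · rw [isOpen_iff_mem_nhds]
    intro x hx
    obtain ⟨t, ht, hst⟩ := exists_lt_of_lt_csSup (hTn x) hx
    rcases ht with rfl | ⟨d, hd, rfl⟩
    · exact Filter.mem_of_superset univ_mem fun y _ => lt_of_lt_of_le hst (h0 y)
    · refine mem_of_superset ((c.oQ d).mem_nhds ((hlt' _ _).1 hd)) ?_
      intro y hy
      exact hst.trans_le (hge d y ((hlt' _ _).2 hy))
  · rw [isOpen_iff_mem_nhds]
    intro x hx
    have hx' : f x < s := hx
    by_cases hs : 1 < s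
    · refine Filter.mem_of_superset univ_mem fun y _ => ?_
      refine lt_of_le_of_lt (csSup_le (hTn y) ?_) hs
      rintro t (rfl | ⟨d, _, rfl⟩)
      · exact zero_le_one
      · exact (hφ1 d).le
    · obtain ⟨q, hq1, hq2⟩ := exists_rat_btwn hx'
      obtain ⟨q', hq3, hq4⟩ := exists_rat_btwn hq2
      have h1 : (0:ℝ) < q := (h0 x).trans_lt hq1
      have e1 : (0:ℚ) < q := by exact_mod_cast h1
      have e2 : q < q' := by exact_mod_cast hq3
      have e3 : (q':ℝ) < 1 := hq4.trans_le (not_lt.1 hs)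
      have e4 : q' < 1 := by exact_mod_cast e3
      let d : D := φ.symm ⟨q', e1.trans e2, e4⟩
      have hd : ((φ d : ℚ) : ℝ) = q' := by simp [d]
      have hxd : x < d := by
        by_contra hcon
        have hdx : (d : Y) ≤ x := not_lt.1 hcon
        let e : D := φ.symm ⟨q, e1, e2.trans e4⟩
        have he : ((φ e : ℚ) : ℝ) = q := by simp [e]
        have hed : e < d := φ.symm.strictMono (by exact e2)
        have := hge e x (lt_of_lt_of_le hed hdx)
        rw [he] at this
        exact absurd this (not_le.2 hq1)
      refine mem_of_superset ((c.oP d).mem_nhds hxd) ?_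
      intro y hy
      have hyd : y < d := hy
      have := hle d y hyd.le
      rw [hd] at this
      exact this.trans_lt hq4

end CutSys
lemma frontier_comp {Y : Type*} [TopologicalSpace Y] [LocallyConnectedSpace Y] {W : Set Y}
    (hW : IsOpen W) (x : Y) : frontier (connectedComponentIn W x) ⊆ frontier W := by
  intro y hy
  rw [(hW.connectedComponentIn).frontier_eq] at hy
  rw [hW.frontier_eq]
  refine ⟨closure_mono (connectedComponentIn_subset _ _) hy.1, fun hyW => hy.2 ?_⟩
  obtain ⟨z, hz1, hz2⟩ := mem_closure_iff.1 hy.1 _ (hW.connectedComponentIn (x := y))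
    (mem_connectedComponentIn hyW)
  rw [connectedComponentIn_eq hz2, ← connectedComponentIn_eq hz1]
  exact mem_connectedComponentIn hyW

lemma local_arc {Y : Type*} [TopologicalSpace Y] [CompactSpace Y]
    [TopologicalSpace.MetrizableSpace Y] [ConnectedSpace Y] (hY : RegB Y) {U : Set Y}
    (hU : IsOpen U) (h2 : ∀ x ∈ U, HasOrderTwo x) {x : Y} (hx : x ∈ U) :
    ∃ C : Set Y, IsOpen C ∧ IsPreconnected C ∧ x ∈ C ∧ closure C ⊆ U ∧ (frontier C).Finite ∧
      ∃ f : C → ℝ, IsOpenEmbedding f ∧ BddAbove (range f) ∧ BddBelow (range f) := by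
  have hlc := hY.locallyConnected
  obtain ⟨hle2, hn1⟩ := h2 x hx
  simp only [HasOrderLE, not_forall] at hn1
  obtain ⟨U0, hU0, hxU0, hno⟩ := hn1
  obtain ⟨t, ht, htc, htU⟩ := exists_mem_nhds_isClosed_subset ((hU.inter hU0).mem_nhds ⟨hx, hxU0⟩)
  obtain ⟨W, hW, hxW, hWt, hWf, hWn⟩ := hle2 (interior t) isOpen_interior
    (mem_interior_iff_mem_nhds.2 ht)
  obtain ⟨C, hCdef⟩ : ∃ C, C = connectedComponentIn W x := ⟨_, rfl⟩
  have hCW : C ⊆ W := hCdef ▸ connectedComponentIn_subset _ _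
  have hCo : IsOpen C := hCdef ▸ hW.connectedComponentIn
  have hCc : IsPreconnected C := hCdef ▸ isPreconnected_connectedComponentIn
  have hxC : x ∈ C := hCdef ▸ mem_connectedComponentIn hxW
  have hCf : frontier C ⊆ frontier W := hCdef ▸ frontier_comp hW x
  have hclC : closure C ⊆ U ∩ U0 :=
    (closure_minimal (hCW.trans (hWt.trans interior_subset)) htc).trans htU
  have hCfin : (frontier C).Finite := hWf.subset hCf
  have hC2 : (frontier C).ncard = 2 := by
    have h1 : (frontier C).ncard ≤ 2 := (ncard_le_ncard hCf hWf).trans hWn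
    have h3 : ¬ (frontier C).ncard ≤ 1 := fun h =>
      hno ⟨C, hCo, hxC, fun y hy => (hclC (subset_closure hy)).2, hCfin, h⟩
    omega
  obtain ⟨a, b, hab, hCab⟩ := ncard_eq_two.1 hC2
  have haC : a ∉ C := fun h => by
    have : a ∈ frontier C := by rw [hCab]; simp
    rw [hCo.frontier_eq] at this
    exact this.2 h
  have hbC : b ∉ C := fun h => by
    have : b ∈ frontier C := by rw [hCab]; simp
    rw [hCo.frontier_eq] at this
    exact this.2 h
  have hcl : ∀ y ∈ closure C, y ≠ a → y ≠ b → y ∈ C := by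
    intro y hy h1 h3
    by_contra h
    have : y ∈ frontier C := by rw [hCo.frontier_eq]; exact ⟨hy, h⟩
    rw [hCab] at this
    rcases this with h | h
    · exact h1 h
    · exact h3 h
  have hacl : a ∈ closure C := frontier_subset_closure (by rw [hCab]; simp)
  have hbcl : b ∈ closure C := frontier_subset_closure (by rw [hCab]; simp)
  obtain ⟨A, hAC, hAcl, hAc, haA, hbA, hAmin⟩ := exists_irred isClosed_closure hCc.closure hacl hbcl
  have : CompactSpace A := isCompact_iff_compactSpace.1 hAcl.isCompact
  have : ConnectedSpace A := isConnected_iff_connectedSpace.1 ⟨⟨a, haA⟩, hAc⟩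
  have : LocallyConnectedSpace A := (hY.sub A).locallyConnected
  obtain ⟨c⟩ := cut_exists (Y := A) (a := ⟨a, haA⟩) (b := ⟨b, hbA⟩) (by
    intro K hK hKc h1 h3
    have := hAmin (Subtype.val '' K) (by rintro _ ⟨y, _, rfl⟩; exact y.2)
      (hAcl.isClosedMap_subtype_val _ hK) (hKc.image _ continuous_subtype_val.continuousOn)
      ⟨_, h1, rfl⟩ ⟨_, h3, rfl⟩
    ext y
    simp only [mem_univ, iff_true]
    have hy : (y : Y) ∈ Subtype.val '' K := by rw [this]; exact y.2
    obtain ⟨z, hz, hzy⟩ := hy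
    exact Subtype.ext hzy ▸ hz)
  have hCA : C ⊆ A := by
    intro z hzC
    by_contra hzA
    have hCAo : IsOpen (C \ A) := hCo.sdiff hAcl
    obtain ⟨R, hR⟩ : ∃ R, R = connectedComponentIn (C \ A) z := ⟨_, rfl⟩
    have hRo : IsOpen R := hR ▸ hCAo.connectedComponentIn
    have hRc : IsPreconnected R := hR ▸ isPreconnected_connectedComponentIn
    have hzR : z ∈ R := hR ▸ mem_connectedComponentIn ⟨hzC, hzA⟩
    have hRs : R ⊆ C \ A := hR ▸ connectedComponentIn_subset _ _
    have hRf : frontier R ⊆ frontier (C \ A) := hR ▸ frontier_comp hCAo z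
    have hACne : ∃ w ∈ A, w ∈ C := by
      by_contra! hcon
      have hsub : A ⊆ {a, b} := by
        intro w hw
        by_contra hw2
        simp only [mem_insert_iff, mem_singleton_iff, not_or] at hw2
        exact hcon w hw (hcl w (hAC hw) hw2.1 hw2.2)
      exact (hAc.infinite_of_nontrivial ⟨a, haA, b, hbA, hab⟩) ((toFinite _).subset hsub)
    obtain ⟨w, hwA, hwC⟩ := hACne
    obtain ⟨q, hqC, hqR⟩ := cross_frontier hCc hRo ⟨z, hzC, hzR⟩ ⟨w, hwC, fun h => (hRs h).2 hwA⟩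
    have hqA : q ∈ A := by
      by_contra h
      have := hRf hqR
      rw [hCAo.frontier_eq] at this
      exact this.2 ⟨hqC, h⟩
    have hqcl : q ∈ closure R := frontier_subset_closure hqR
    obtain ⟨N, hN, hqN, hNs, hNf, hN2⟩ := (h2 q (hclC (subset_closure hqC)).1).1 ({a, b, z}ᶜ)
      (toFinite _).isClosed.isOpen_compl (by
        simp only [mem_compl_iff, mem_insert_iff, mem_singleton_iff, not_or]
        exact ⟨fun h => haC (h ▸ hqC), fun h => hbC (h ▸ hqC), fun h => hzA (h ▸ hqA)⟩)
    have hqf : q ∉ frontier N := fun h => by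
      rw [hN.frontier_eq] at h
      exact h.2 hqN
    obtain ⟨u1, hu1, hu1'⟩ := cross_frontier hRc hN
      (by rw [inter_comm]; exact mem_closure_iff.1 hqcl N hN hqN)
      ⟨z, hzR, fun h => hNs h (by simp)⟩
    obtain ⟨_, ⟨p2, hp2, rfl⟩, hu2⟩ := cross_frontier
      ((c.connP ⟨q, hqA⟩).image _ continuous_subtype_val.continuousOn) hN
      ⟨q, ⟨_, mem_insert _ _, rfl⟩, hqN⟩
      ⟨a, ⟨_, c.ha _, rfl⟩, fun h => hNs h (by simp)⟩
    obtain ⟨_, ⟨p3, hp3, rfl⟩, hu3⟩ := cross_frontier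
      ((c.connQ ⟨q, hqA⟩).image _ continuous_subtype_val.continuousOn) hN
      ⟨q, ⟨_, mem_insert _ _, rfl⟩, hqN⟩
      ⟨b, ⟨_, c.hb _, rfl⟩, fun h => hNs h (by simp)⟩
    have hp2' : p2 ∈ c.P ⟨q, hqA⟩ := hp2.resolve_left (fun h => hqf (by rw [h] at hu2; exact hu2))
    have hp3' : p3 ∈ c.Q ⟨q, hqA⟩ := hp3.resolve_left (fun h => hqf (by rw [h] at hu3; exact hu3))
    have e12 : u1 ≠ p2 := fun h => (hRs hu1).2 (h ▸ p2.2)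
    have e13 : u1 ≠ p3 := fun h => (hRs hu1).2 (h ▸ p3.2)
    have e23 : (p2 : Y) ≠ p3 := fun h =>
      disjoint_left.1 (c.disj _) hp2' ((Subtype.ext h : p2 = p3) ▸ hp3')
    have hsub : ({u1, (p2 : Y), (p3 : Y)} : Set Y) ⊆ frontier N := by
      rintro y (rfl | rfl | rfl) <;> assumption
    have h3 : ({u1, (p2 : Y), (p3 : Y)} : Set Y).ncard = 3 :=
      ncard_eq_three.2 ⟨_, _, _, e12, e13, e23, rfl⟩
    have := ncard_le_ncard hsub hNf
    omega
  obtain ⟨f, hf, hinj, hbd⟩ := c.arc (fun h => hab (congrArg Subtype.val h))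
  have hemb : IsEmbedding f := (hf.isClosedEmbedding hinj).isEmbedding
  let g : C → ℝ := f ∘ inclusion hCA
  have hg : IsEmbedding g := hemb.comp (IsEmbedding.inclusion hCA)
  have hr : range g = Ioo (f ⟨a, haA⟩) (f ⟨b, hbA⟩) := by
    ext s
    constructor
    · rintro ⟨y, rfl⟩
      refine ⟨lt_of_le_of_ne (hbd _).1 fun h => ?_, lt_of_le_of_ne (hbd _).2 fun h => ?_⟩
      · exact haC (by have := congrArg Subtype.val (hinj h); simp at this; rw [this]; exact y.2)
      · exact hbC (by have := congrArg Subtype.val (hinj h); simp at this; rw [← this]; exact y.2)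
    · intro hs
      obtain ⟨y, rfl⟩ := intermediate_value_univ _ _ hf (Ioo_subset_Icc_self hs)
      refine ⟨⟨y, hcl y (hAC y.2) ?_ ?_⟩, rfl⟩
      · intro h
        have : y = ⟨a, haA⟩ := Subtype.ext h
        rw [this] at hs
        exact lt_irrefl _ hs.1
      · intro h
        have : y = ⟨b, hbA⟩ := Subtype.ext h
        rw [this] at hs
        exact lt_irrefl _ hs.2
  refine ⟨C, hCo, hCc, hxC, fun y hy => (hclC hy).1, hCfin, g, ⟨hg, hr ▸ isOpen_Ioo⟩, ?_, ?_⟩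
  · rw [hr]; exact bddAbove_Ioo
  · rw [hr]; exact bddBelow_Ioo
lemma Ioo_homeo {s t : ℝ} (h : s < t) : Nonempty (Ioo s t ≃ₜ Ioo (0:ℝ) 1) := by
  have hp : 0 < t - s := sub_pos.2 h
  have himg := affineHomeomorph_image_Ioo (t - s) s 0 1 hp
  have e := (affineHomeomorph (t - s) s hp.ne').image (Ioo (0:ℝ) 1)
  have himg2 : affineHomeomorph (t - s) s hp.ne' '' Ioo (0:ℝ) 1 = Ioo s t := by
    rw [himg]; simp
  exact ⟨(e.trans (Homeomorph.setCongr himg2)).symm⟩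

lemma open_conn_homeo {Y : Type*} [TopologicalSpace Y] {C C' : Set Y} (hC' : IsOpen C')
    (hc : IsConnected C') (hs : C' ⊆ C) {f : C → ℝ} (hf : IsOpenEmbedding f)
    (h1 : BddAbove (range f)) (h2 : BddBelow (range f)) : Nonempty (C' ≃ₜ Ioo (0:ℝ) 1) := by
  let g : C' → ℝ := f ∘ inclusion hs
  have hg : IsOpenEmbedding g := hf.comp
    (.of_continuous_injective_isOpenMap (continuous_inclusion hs) (inclusion_injective hs)
      (hC'.isOpenMap_inclusion hs))
  have : ConnectedSpace C' := isConnected_iff_connectedSpace.1 hc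
  have hgc : IsConnected (range g) := isConnected_range hg.continuous
  have hsub : range g ⊆ range f := range_comp_subset_range _ _
  have hb := h1.mono hsub
  have hb' := h2.mono hsub
  have hr : range g = Ioo (sInf (range g)) (sSup (range g)) := by
    refine subset_antisymm ?_ (hgc.Ioo_csInf_csSup_subset hb' hb)
    intro y hy
    have hn := hg.isOpen_range.mem_nhds hy
    obtain ⟨l, u, hlu, hlus⟩ := mem_nhds_iff_exists_Ioo_subset.1 hn
    obtain ⟨p, hp1, hp2⟩ := exists_between hlu.1
    obtain ⟨q, hq1, hq2⟩ := exists_between hlu.2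
    exact ⟨(csInf_le hb' (hlus ⟨hp1, hp2.trans hlu.2⟩)).trans_lt hp2,
      hq1.trans_le (le_csSup hb (hlus ⟨hlu.1.trans hq1, hq2⟩))⟩
  have hlt : sInf (range g) < sSup (range g) := by
    obtain ⟨y, hy⟩ := hgc.nonempty
    rw [hr] at hy
    exact hy.1.trans hy.2
  obtain ⟨e⟩ := Ioo_homeo hlt
  exact ⟨(hg.isEmbedding.toHomeomorph.trans (Homeomorph.setCongr hr)).trans e⟩

lemma glue {Y : Type*} [TopologicalSpace Y] {E : Type} [TopologicalSpace E] [DiscreteTopology E]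
    (S : E → Set Y) (ho : ∀ e, IsOpen (S e)) (hd : ∀ e e', e ≠ e' → Disjoint (S e) (S e'))
    (h : ∀ e, Nonempty (S e ≃ₜ Ioo (0:ℝ) 1)) {M : Set Y} (hM : M = ⋃ e, S e) :
    Nonempty (M ≃ₜ E × Ioo (0:ℝ) 1) := by
  have k : ∀ e, S e ≃ₜ Ioo (0:ℝ) 1 := fun e => Classical.choice (h e)
  let g : E × Ioo (0:ℝ) 1 → Y := fun p => ((k p.1).symm p.2 : Y)
  have hg : IsOpenEmbedding g := by
    refine .of_continuous_injective_isOpenMap ?_ ?_ ?_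
    · rw [continuous_prod_of_discrete_left]
      intro e
      exact continuous_subtype_val.comp (k e).symm.continuous
    · rintro ⟨e, s⟩ ⟨e', s'⟩ hh
      have hh' : ((k e).symm s : Y) = ((k e').symm s' : Y) := hh
      have : e = e' := by
        by_contra hne
        exact disjoint_left.1 (hd e e' hne) ((k e).symm s).2 (hh' ▸ ((k e').symm s').2)
      subst this
      have := (k e).symm.injective (Subtype.ext hh')
      rw [this]
    · rw [isOpenMap_prod_of_discrete_left]
      intro e
      exact (ho e).isOpenMap_subtype_val.comp (k e).symm.isOpenMap
  have hr : range g = M := by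
    rw [hM]
    ext y
    simp only [mem_range, mem_iUnion]
    constructor
    · rintro ⟨p, rfl⟩
      exact ⟨p.1, ((k p.1).symm p.2).2⟩
    · rintro ⟨e, he⟩
      exact ⟨(e, k e ⟨y, he⟩), by simp [g]⟩
  exact ⟨(hg.isEmbedding.toHomeomorph.trans (Homeomorph.setCongr hr)).symm⟩

lemma order_two_of_embed {Y : Type*} [TopologicalSpace Y] [T2Space Y] {k : ℝ → Y}
    (hk : IsOpenEmbedding k) (t : ℝ) : HasOrderTwo (k t) := by
  constructor
  · intro U hU hx
    have hn : k ⁻¹' U ∈ 𝓝 t := hk.continuous.continuousAt.preimage_mem_nhds (hU.mem_nhds hx)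
    obtain ⟨l, u, hlu, hs⟩ := mem_nhds_iff_exists_Ioo_subset.1 hn
    have hfr : frontier (k '' Ioo l u) ⊆ k '' Icc l u := by
      refine frontier_subset_closure.trans (closure_minimal (image_mono Ioo_subset_Icc_self) ?_)
      exact (isCompact_Icc.image hk.continuous).isClosed
    have hfr2 : frontier (k '' Ioo l u) ⊆ {k l, k u} := by
      intro y hy
      obtain ⟨s, hs, rfl⟩ := hfr hy
      rw [(hk.isOpenMap _ isOpen_Ioo).frontier_eq] at hy
      have : s ∉ Ioo l u := fun h => hy.2 ⟨s, h, rfl⟩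
      by_cases h1 : s = l
      · left; rw [h1]
      · right
        by_contra h2
        exact this ⟨lt_of_le_of_ne hs.1 (Ne.symm h1), lt_of_le_of_ne hs.2 (fun h => h2 (by rw [h]; rfl))⟩
    exact ⟨k '' Ioo l u, hk.isOpenMap _ isOpen_Ioo, ⟨t, hlu, rfl⟩, image_subset_iff.2 hs,
      (toFinite _).subset hfr2, (ncard_le_ncard hfr2 (toFinite _)).trans (by
        have := ncard_insert_le (k l) {k u}
        rw [ncard_singleton] at this
        exact this)⟩
  · intro h
    obtain ⟨W, hW, hx, hWs, hf, hc⟩ := h (k '' Ioo (t-1) (t+1)) (hk.isOpenMap _ isOpen_Ioo)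
      ⟨t, ⟨by linarith, by linarith⟩, rfl⟩
    have hnf : k t ∉ frontier W := fun h => by
      rw [hW.frontier_eq] at h
      exact h.2 hx
    obtain ⟨_, ⟨s1, hs1, rfl⟩, h1⟩ := cross_frontier
      ((isPreconnected_Icc (a := t) (b := t+1)).image k hk.continuous.continuousOn) hW
      ⟨k t, ⟨t, ⟨le_rfl, by linarith⟩, rfl⟩, hx⟩
      ⟨k (t+1), ⟨t+1, ⟨by linarith, le_rfl⟩, rfl⟩, fun h => by
        obtain ⟨s, hs, he⟩ := hWs h
        have := hk.injective he
        linarith [hs.2]⟩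
    obtain ⟨_, ⟨s2, hs2, rfl⟩, h2⟩ := cross_frontier
      ((isPreconnected_Icc (a := t-1) (b := t)).image k hk.continuous.continuousOn) hW
      ⟨k t, ⟨t, ⟨by linarith, le_rfl⟩, rfl⟩, hx⟩
      ⟨k (t-1), ⟨t-1, ⟨le_rfl, by linarith⟩, rfl⟩, fun h => by
        obtain ⟨s, hs, he⟩ := hWs h
        have := hk.injective he
        linarith [hs.1]⟩
    have hne : k s1 ≠ k s2 := by
      intro he
      have he := hk.injective he
      have : s1 = t := le_antisymm (he ▸ hs2.2) hs1.1
      exact hnf (this ▸ h1)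
    have := (ncard_le_one hf).1 hc _ h1 _ h2
    exact hne this

lemma order_two_of_homeo {Y : Type*} [TopologicalSpace Y] [T2Space Y] {E : Type}
    [TopologicalSpace E] [DiscreteTopology E] {M : Set Y} (hM : IsOpen M)
    (h : M ≃ₜ E × Ioo (0:ℝ) 1) {x : Y} (hx : x ∈ M) : HasOrderTwo x := by
  obtain ⟨e1⟩ := Ioo_homeo (show (-1:ℝ) < 1 by norm_num)
  let j : ℝ ≃ₜ Ioo (0:ℝ) 1 := (orderIsoIooNegOneOne ℝ).toHomeomorph.trans e1
  obtain ⟨e, he⟩ : ∃ e, e = (h ⟨x, hx⟩).1 := ⟨_, rfl⟩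
  have h1 : IsOpenEmbedding (fun s : Ioo (0:ℝ) 1 => (e, s)) := by
    refine .of_continuous_injective_isOpenMap (by fun_prop) (fun s s' h => (Prod.mk.inj h).2) ?_
    intro O hO
    have : (fun s : Ioo (0:ℝ) 1 => (e, s)) '' O = {e} ×ˢ O := by
      ext ⟨p, q⟩
      simp only [eq_comm, mem_image, Prod.mk.injEq, mem_prod, mem_singleton_iff]
      grind
    rw [this]
    exact (isOpen_discrete _).prod hO
  have hk : IsOpenEmbedding (Subtype.val ∘ h.symm ∘ (fun s : Ioo (0:ℝ) 1 => (e, s)) ∘ j) :=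
    hM.isOpenEmbedding_subtypeVal.comp
      (h.symm.isOpenEmbedding.comp (h1.comp j.isOpenEmbedding))
  have := order_two_of_embed hk (j.symm (h ⟨x, hx⟩).2)
  simpa [he] using this

lemma regB_of {Y : Type*} [TopologicalSpace Y] [CompactSpace Y] [T2Space Y] {V : Set Y}
    (hV : IsClosed V) (htd : TotallyDisconnectedSpace V) (h : ∀ x ∉ V, HasOrderLE x 2) :
    RegB Y := by
  intro x U hU hx
  by_cases hxV : x ∉ V
  · obtain ⟨W, h1, h2, h3, h4, _⟩ := h x hxV U hU hx
    exact ⟨W, h1, h2, h3, h4⟩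
  rw [not_not] at hxV
  have : CompactSpace V := isCompact_iff_compactSpace.1 hV.isCompact
  obtain ⟨s, hs, hxs, hsU⟩ := compact_exists_isClopen_in_isOpen (X := V) (x := ⟨x, hxV⟩)
    (hU.preimage continuous_subtype_val) hx
  obtain ⟨OA, OB, hOA, hOB, hA, hB, hd⟩ := normal_separation
    (hV.isClosedMap_subtype_val _ hs.1) (hV.isClosedMap_subtype_val _ hs.compl.1)
    ((disjoint_image_iff Subtype.val_injective).2 disjoint_compl_right)
  have hK : IsCompact ((OA ∩ U) ∪ OB)ᶜ := ((hOA.inter hU).union hOB).isClosed_compl.isCompact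
  have hKV : ∀ y ∈ ((OA ∩ U) ∪ OB)ᶜ, y ∉ V := by
    intro y hy hyV
    apply hy
    by_cases hys : (⟨y, hyV⟩ : V) ∈ s
    · exact Or.inl ⟨hA ⟨_, hys, rfl⟩, hsU hys⟩
    · exact Or.inr (hB ⟨_, hys, rfl⟩)
  have hex : ∀ y : Y, y ∈ ((OA ∩ U) ∪ OB)ᶜ →
      ∃ W, IsOpen W ∧ y ∈ W ∧ closure W ⊆ Vᶜ ∧ (frontier W).Finite := by
    intro y hy
    obtain ⟨t, ht, htc, htU⟩ := exists_mem_nhds_isClosed_subset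
      (hV.isOpen_compl.mem_nhds (hKV y hy))
    obtain ⟨W, h1, h2, h3, h4, _⟩ := h y (hKV y hy) (interior t) isOpen_interior
      (mem_interior_iff_mem_nhds.2 ht)
    exact ⟨W, h1, h2, (closure_minimal (h3.trans interior_subset) htc).trans htU, h4⟩
  choose! W hW1 hW2 hW3 hW4 using hex
  obtain ⟨F, hFK, hF⟩ := hK.elim_nhds_subcover W (fun y hy => (hW1 y hy).mem_nhds (hW2 y hy))
  have hLc : IsClosed (⋃ y ∈ F, closure (W y)) :=
    isClosed_biUnion_finset fun _ _ => isClosed_closure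
  have hO : IsOpen ((OA ∩ U) \ ⋃ y ∈ F, closure (W y)) := (hOA.inter hU).sdiff hLc
  refine ⟨_, hO, ⟨⟨hA ⟨_, hxs, rfl⟩, hx⟩, ?_⟩, fun y hy => hy.1.2, ?_⟩
  · simp only [mem_iUnion, not_exists]
    intro y hy hxy
    exact hW3 y (hFK y hy) hxy hxV
  · refine (F.finite_toSet.biUnion (t := fun y => frontier (W y))
      fun y hy => hW4 y (hFK y hy)).subset ?_
    intro y hy
    rw [hO.frontier_eq] at hy
    obtain ⟨hyc, hyn⟩ := hy
    have hyL : y ∈ ⋃ y ∈ F, closure (W y) := by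
      by_contra hcon
      have hyK : y ∉ ((OA ∩ U) ∪ OB)ᶜ := by
        intro hyK
        apply hcon
        obtain ⟨i, hi, hyi⟩ := mem_iUnion₂.1 (hF hyK)
        exact mem_iUnion₂.2 ⟨i, hi, subset_closure hyi⟩
      rw [mem_compl_iff, not_not] at hyK
      rcases hyK with h1 | h1
      · exact hyn ⟨h1, hcon⟩
      · obtain ⟨z, hz1, hz2⟩ := mem_closure_iff.1 hyc OB hOB h1
        exact disjoint_left.1 hd hz2.1.1 hz1
    obtain ⟨i, hi, hyi⟩ := mem_iUnion₂.1 hyL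
    refine mem_iUnion₂.2 ⟨i, hi, ?_⟩
    rw [(hW1 i (hFK i hi)).frontier_eq]
    refine ⟨hyi, fun hyW => ?_⟩
    obtain ⟨z, hz1, hz2⟩ := mem_closure_iff.1 hyc _ (hW1 i (hFK i hi)) hyW
    exact hz2.2 (mem_iUnion₂.2 ⟨i, hi, subset_closure hz1⟩)

lemma exists_vertices {Y : Type*} [TopologicalSpace Y] [CompactSpace Y]
    [TopologicalSpace.MetrizableSpace Y] [ConnectedSpace Y] (hY : RegB Y) {V : Set Y}
    (hV : IsClosed V) (htd : TotallyDisconnectedSpace V) (h2 : ∀ x ∉ V, HasOrderTwo x) :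
    ∃ D : Set Y, IsClosed D ∧ TotallyDisconnectedSpace D ∧
      ∀ x ∉ D, Nonempty (connectedComponentIn Dᶜ x ≃ₜ Ioo (0:ℝ) 1) := by
  have hlc := hY.locallyConnected
  have hU : IsOpen Vᶜ := hV.isOpen_compl
  let Good : (Vᶜ : Set Y) → Set Y → Prop := fun x C => IsOpen C ∧ (x : Y) ∈ C ∧
    (frontier C).Finite ∧
      ∃ f : C → ℝ, IsOpenEmbedding f ∧ BddAbove (range f) ∧ BddBelow (range f)
  have hbasis : ∀ x : (Vᶜ : Set Y), (𝓝 x).HasBasis (Good x) (fun C => Subtype.val ⁻¹' C) := by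
    intro x
    constructor
    intro t
    constructor
    · intro ht
      obtain ⟨O, hO, hxO, hOt⟩ : ∃ O : Set Y, IsOpen O ∧ (x : Y) ∈ O ∧ Subtype.val ⁻¹' O ⊆ t := by
        obtain ⟨t', ht', ht'o, hxt'⟩ := mem_nhds_iff.1 ht
        obtain ⟨O, hO, rfl⟩ := isOpen_induced_iff.1 ht'o
        exact ⟨O, hO, hxt', ht'⟩
      obtain ⟨C, hC1, _, hC3, hC4, hC5, hC6⟩ := local_arc hY (U := O ∩ Vᶜ) (hO.inter hU)
        (fun y hy => h2 y hy.2) ⟨hxO, x.2⟩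
      exact ⟨C, ⟨hC1, hC3, hC5, hC6⟩,
        (preimage_mono (fun y hy => (hC4 (subset_closure hy)).1)).trans hOt⟩
    · rintro ⟨C, hC, hCt⟩
      exact mem_of_superset ((hC.1.preimage continuous_subtype_val).mem_nhds hC.2.1) hCt
  have : LocallyCompactSpace (Vᶜ : Set Y) := hU.locallyCompactSpace
  obtain ⟨α, c, r, hr, hcov, hlf⟩ := refinement_of_locallyCompact_sigmaCompact_of_nhds_basis hbasis
  let F : Set Y := ⋃ i, frontier (r i)
  have hLP : ∀ y ∉ V, ∃ O : Set Y, IsOpen O ∧ y ∈ O ∧ O ⊆ Vᶜ ∧ (O ∩ F).Finite := by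
    intro y hy
    obtain ⟨t, ht, htf⟩ := hlf ⟨y, hy⟩
    refine ⟨Subtype.val '' interior t, hU.isOpenMap_subtype_val _ isOpen_interior,
      ⟨_, mem_interior_iff_mem_nhds.2 ht, rfl⟩, by rintro _ ⟨z, _, rfl⟩; exact z.2, ?_⟩
    refine (htf.biUnion (t := fun i => frontier (r i)) fun i _ => (hr i).2.2.1).subset ?_
    rintro z ⟨hz1, hz2⟩
    obtain ⟨i, hi⟩ := mem_iUnion.1 hz2
    refine mem_iUnion₂.2 ⟨i, ?_, hi⟩
    obtain ⟨w, ⟨w', hw', rfl⟩, hw2⟩ := mem_closure_iff.1 (frontier_subset_closure hi) _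
      (hU.isOpenMap_subtype_val _ isOpen_interior) hz1
    exact ⟨w', hw2, interior_subset hw'⟩
  have hDc : IsClosed (V ∪ F) := by
    rw [← isOpen_compl_iff, isOpen_iff_mem_nhds]
    intro y hy
    rw [mem_compl_iff, mem_union, not_or] at hy
    obtain ⟨O, hO, hyO, hOV, hOF⟩ := hLP y hy.1
    refine mem_of_superset ((hO.sdiff hOF.isClosed).mem_nhds ⟨hyO, fun h => hy.2 h.2⟩) ?_
    rintro z ⟨hz1, hz2⟩ (hz | hz)
    · exact hOV hz1 hz
    · exact hz2 ⟨hz1, hz⟩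
  refine ⟨V ∪ F, hDc, ?_, ?_⟩
  · rw [totallyDisconnectedSpace_subtype_iff] at htd ⊢
    intro t ht htc
    by_cases htV : t ⊆ V
    · exact htd t htV htc
    obtain ⟨y, hyt, hyV⟩ := not_subset.1 htV
    obtain ⟨O, hO, hyO, hOV, hOF⟩ := hLP y hyV
    have hO' : IsOpen (O \ ((O ∩ F) \ {y})) := hO.sdiff (hOF.subset sdiff_subset).isClosed
    have hall : ∀ z ∈ t, z = y := by
      intro z hz
      by_contra hzy
      obtain ⟨w, hwt, hw1, hw2⟩ := htc _ ({y}ᶜ) hO' isOpen_compl_singleton (by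
        intro w _
        by_cases hw : w = y
        · left; rw [hw]; exact ⟨hyO, fun h => h.2 rfl⟩
        · exact Or.inr hw) ⟨y, hyt, hyO, fun h => h.2 rfl⟩ ⟨z, hz, hzy⟩
      refine hw1.2 ⟨⟨hw1.1, ?_⟩, hw2⟩
      exact (ht hwt).resolve_left (hOV hw1.1)
    intro p hp q hq
    rw [hall p hp, hall q hq]
  · intro x hx
    have hxV : x ∉ V := fun h => hx (Or.inl h)
    have hxc : (⟨x, hxV⟩ : (Vᶜ : Set Y)) ∈ ⋃ a, Subtype.val ⁻¹' (r a) := hcov ▸ mem_univ _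
    obtain ⟨i, hi⟩ := mem_iUnion.1 hxc
    have hi' : x ∈ r i := hi
    obtain ⟨f, hf1, hf2, hf3⟩ := (hr i).2.2.2
    refine open_conn_homeo (C := r i) hDc.isOpen_compl.connectedComponentIn
      (isConnected_connectedComponentIn_iff.2 hx) ?_ hf1 hf2 hf3
    by_contra hns
    obtain ⟨z, hz1, hz2⟩ := not_subset.1 hns
    obtain ⟨w, hw1, hw2⟩ := cross_frontier (isPreconnected_connectedComponentIn (F := (V ∪ F)ᶜ))
      (hr i).1 ⟨x, mem_connectedComponentIn hx, hi'⟩ ⟨z, hz1, hz2⟩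
    exact connectedComponentIn_subset _ _ hw1 (Or.inr (mem_iUnion.2 ⟨i, hw2⟩))

lemma graphLike_of {Y : Type u} [TopologicalSpace Y] [CompactSpace Y]
    [TopologicalSpace.MetrizableSpace Y] [LocallyConnectedSpace Y] {D : Set Y} (hD : IsClosed D)
    (htd : TotallyDisconnectedSpace D)
    (h : ∀ x ∉ D, Nonempty (connectedComponentIn Dᶜ x ≃ₜ Ioo (0:ℝ) 1)) :
    Nonempty (GraphLike Y) := by
  let K : Set (Set Y) := {S | ∃ x ∉ D, S = connectedComponentIn Dᶜ x}
  have hd : ∀ S ∈ K, ∀ T ∈ K, S ≠ T → Disjoint S T := by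
    rintro _ ⟨x, hx, rfl⟩ _ ⟨y, hy, rfl⟩ hne
    rw [disjoint_left]
    intro z hz1 hz2
    exact hne ((connectedComponentIn_eq hz1).trans (connectedComponentIn_eq hz2).symm)
  have ho : ∀ S ∈ K, IsOpen S := by
    rintro _ ⟨x, hx, rfl⟩
    exact hD.isOpen_compl.connectedComponentIn
  have hK : K.Countable := Set.PairwiseDisjoint.countable_of_isOpen (s := id)
    (fun S hS T hT hne => hd S hS T hT hne) ho (by
      rintro _ ⟨x, hx, rfl⟩
      exact ⟨x, mem_connectedComponentIn hx⟩)
  have : Countable K := hK.to_subtype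
  obtain ⟨e, he⟩ := exists_injective_nat K
  let ε := Equiv.ofInjective e he
  have hhomeo : ∀ τ : TopologicalSpace (range e), @DiscreteTopology _ τ →
      Nonempty ((Dᶜ : Set Y) ≃ₜ (range e) × Ioo (0:ℝ) 1) := by
    intro τ hτ
    refine glue (fun n => (ε.symm n : Set Y)) (fun n => ho _ (ε.symm n).2)
      (fun n m hnm => hd _ (ε.symm n).2 _ (ε.symm m).2 fun hh =>
        hnm (ε.symm.injective (Subtype.ext hh))) ?_ ?_
    · intro n
      obtain ⟨x, hx, hS⟩ := (ε.symm n).2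
      rw [hS]
      exact h x hx
    · ext y
      simp only [mem_iUnion]
      constructor
      · intro hy
        exact ⟨ε ⟨_, y, hy, rfl⟩, by simpa using mem_connectedComponentIn hy⟩
      · rintro ⟨n, hn⟩
        obtain ⟨x, hx, hS⟩ := (ε.symm n).2
        rw [hS] at hn
        exact connectedComponentIn_subset _ _ hn
  exact ⟨⟨D, hD, htd, range e, hhomeo ⊥ (@DiscreteTopology.mk _ ⊥ rfl)⟩⟩

/-- A continuum is graph-like iff it is regular and has a closed
zero-dimensional subset `V` such that all points outside `V` have order `2`. -/
theorem graphLike_iff_regular_orderTwo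
    [CompactSpace X] [TopologicalSpace.MetrizableSpace X] [ConnectedSpace X] :
    Nonempty (GraphLike X) ↔
      ((∃ B : Set (Set X), TopologicalSpace.IsTopologicalBasis B ∧
          ∀ U ∈ B, (frontier U).Finite) ∧
        ∃ V : Set X, IsClosed V ∧ TotallyDisconnectedSpace V ∧
          ∀ x ∉ V, HasOrderTwo x) := by
  constructor
  · rintro ⟨G⟩
    have h2 : ∀ x ∉ G.V, HasOrderTwo x := by
      intro x hx
      let τ : TopologicalSpace G.E := ⊥
      have hτ : DiscreteTopology G.E := ⟨rfl⟩
      obtain ⟨h⟩ := G.homeo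
      exact order_two_of_homeo G.closedV.isOpen_compl h hx
    have hreg : RegB X := regB_of G.closedV G.zeroDimV fun x hx => (h2 x hx).1
    refine ⟨⟨{W | IsOpen W ∧ (frontier W).Finite}, ?_, fun U hU => hU.2⟩,
      G.V, G.closedV, G.zeroDimV, h2⟩
    refine TopologicalSpace.isTopologicalBasis_of_isOpen_of_nhds (fun W hW => hW.1) ?_
    intro x U hx hU
    obtain ⟨W, h1, h3, h4, h5⟩ := hreg x U hU hx
    exact ⟨W, ⟨h1, h5⟩, h3, h4⟩
  · rintro ⟨_, V, hV, htd, h2⟩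
    have hreg : RegB X := regB_of hV htd fun x hx => (h2 x hx).1
    have hlc := hreg.locallyConnected
    obtain ⟨D, hD, hDt, hDh⟩ := exists_vertices hreg hV htd h2
    exact graphLike_of hD hDt hDh
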